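/- Let n ≥ 5 and let d be a metric on V_n, regarded as the vector in ℝ^{C(n,2)} whose {i,j}-coordinate is d(i,j). Then the unique solution w of the linear system S_sq·w = d has coordinates w_{{i,j}} = −(1/2)·d(i,j) − Tr(d)/((n − 2)(n − 4)) + (s_i + s_j)/(2(n − 4)) for every 2-element subset {i,j} ⊆ V_n. -/

import Mathlib

open Finset Matrix

/-- A metric on a finite set. -/
def IsMetric {α : Type*} (d : α → α → ℝ) : Prop :=
  (∀ i, d i i = 0) ∧ (∀ i j, d i j = d j i) ∧
  (∀ i j, i ≠ j → 0 < d i j) ∧ (∀ i j k, d i j ≤ d i k + d k j)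

/-- The trace `Tr(d) = ∑_{i<j} d(i,j)`. -/
def traceMetric {n : ℕ} (d : Fin n → Fin n → ℝ) : ℝ :=
  ∑ i : Fin n, ∑ j ∈ Finset.univ.filter (fun j => i < j), d i j

/-- The star trace `s_i = ∑_{j ≠ i} d(i,j)`. -/
def starTrace {n : ℕ} (d : Fin n → Fin n → ℝ) (i : Fin n) : ℝ :=
  ∑ j ∈ Finset.univ.erase i, d i j

/-- The 2-element subsets of `V_n = Fin n`. -/
abbrev Pairs (n : ℕ) := {P : Finset (Fin n) // P.card = 2}

/-- The square cut-matrix `S_sq`. -/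
def sqCutMatrix (n : ℕ) : Matrix (Pairs n) (Pairs n) ℝ :=
  Matrix.of fun P Q => if (P.1 ∩ Q.1).card = 1 then 1 else 0

/-- For a symmetric function `d` vanishing on the diagonal, `pairEval d {i,j} = d i j`:
this realizes `d` as a vector in `ℝ^{C(n,2)}`. -/
noncomputable def pairEval {n : ℕ} (d : Fin n → Fin n → ℝ) (P : Finset (Fin n)) : ℝ :=
  (∑ i ∈ P, ∑ j ∈ P, d i j) / 2

/-- The symmetric matrix with zero diagonal whose `(i, j)` entry is the `{i, j}` coordinate of `w`. -/
noncomputable def pairMatrix {n : ℕ} (w : Pairs n → ℝ) (i j : Fin n) : ℝ :=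
  if h : i = j then 0 else w ⟨{i, j}, Finset.card_pair h⟩

lemma pairMatrix_self {n : ℕ} (w : Pairs n → ℝ) (i : Fin n) : pairMatrix w i i = 0 := by
  simp [pairMatrix]

lemma pairMatrix_of_ne {n : ℕ} (w : Pairs n → ℝ) {i j : Fin n} (h : i ≠ j) :
    pairMatrix w i j = w ⟨{i, j}, Finset.card_pair h⟩ := by
  simp [pairMatrix, h]

lemma starTrace_eq_sum {n : ℕ} {d : Fin n → Fin n → ℝ} (h0 : ∀ i, d i i = 0) (i : Fin n) :
    starTrace d i = ∑ j, d i j := by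
  rw [starTrace, Finset.sum_erase _ (h0 i)]

lemma two_mul_traceMetric {n : ℕ} {d : Fin n → Fin n → ℝ} (h0 : ∀ i, d i i = 0)
    (hs : ∀ i j, d i j = d j i) : 2 * traceMetric d = ∑ i, ∑ j, d i j := by
  have hsplit : ∀ i j, d i j = (if i < j then d i j else 0) + (if j < i then d j i else 0) := by
    intro i j
    rcases lt_trichotomy i j with h | rfl | h
    · simp [h, h.not_gt]
    · simp [h0]
    · simp [h, h.not_gt, hs i j]
  have hsum : ∑ i, ∑ j, d i j = ∑ i, ∑ j, ((if i < j then d i j else 0) +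
      (if j < i then d j i else 0)) :=
    Finset.sum_congr rfl fun i _ => Finset.sum_congr rfl fun j _ => hsplit i j
  rw [hsum]
  simp only [Finset.sum_add_distrib]
  rw [Finset.sum_comm (f := fun i j => if j < i then d j i else 0)]
  simp only [traceMetric, Finset.sum_filter]
  ring

lemma pairEval_pair {n : ℕ} {d : Fin n → Fin n → ℝ} (h0 : ∀ i, d i i = 0)
    (hs : ∀ i j, d i j = d j i) {i j : Fin n} (hij : i ≠ j) : pairEval d {i, j} = d i j := by
  simp only [pairEval, Finset.sum_pair hij, h0, hs j i]
  ring

lemma sum_mem_eq_sum_pairMatrix {n : ℕ} (w : Pairs n → ℝ) (i : Fin n) :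
    ∑ Q : Pairs n, (if i ∈ Q.1 then w Q else 0) = ∑ k, pairMatrix w i k := by
  rw [← Finset.sum_filter, ← Finset.sum_erase _ (pairMatrix_self w i)]
  symm
  refine Finset.sum_bij
    (fun k hk => ⟨{i, k}, Finset.card_pair (Finset.ne_of_mem_erase hk).symm⟩) ?_ ?_ ?_ ?_
  · intro k hk
    simp
  · intro k hk l hl h
    have hmem : k ∈ ({i, l} : Finset (Fin n)) := by
      rw [← Subtype.mk.inj h]
      simp
    simpa [Finset.ne_of_mem_erase hk] using hmem
  · rintro ⟨Q, hQ⟩ hiQ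
    have hi : i ∈ Q := by simpa using hiQ
    obtain ⟨k, hk⟩ := Finset.card_eq_one.mp (show (Q.erase i).card = 1 by
      rw [Finset.card_erase_of_mem hi, hQ])
    have hki : k ∈ Q.erase i := by simp [hk]
    refine ⟨k, by simpa using Finset.ne_of_mem_erase hki, ?_⟩
    ext1
    change {i, k} = Q
    rw [← Finset.insert_erase hi, hk]
  · intro k hk
    exact pairMatrix_of_ne w (Finset.ne_of_mem_erase hk).symm

lemma sqCutMatrix_apply_pair {n : ℕ} {i j : Fin n} (hij : i ≠ j) (Q : Pairs n) :
    sqCutMatrix n ⟨{i, j}, Finset.card_pair hij⟩ Q =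
      (if i ∈ Q.1 then 1 else 0) + (if j ∈ Q.1 then 1 else 0) -
        2 * (if Q = ⟨{i, j}, Finset.card_pair hij⟩ then 1 else 0) := by
  obtain ⟨Q, hQ⟩ := Q
  have hiff : Q = {i, j} ↔ i ∈ Q ∧ j ∈ Q := by
    refine ⟨by rintro rfl; simp, fun ⟨hi, hj⟩ => (Finset.eq_of_subset_of_card_le ?_ ?_).symm⟩
    · simp [Finset.insert_subset_iff, hi, hj]
    · rw [hQ, Finset.card_pair hij]
  simp only [sqCutMatrix, Matrix.of_apply, Subtype.mk.injEq, hiff]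
  by_cases hi : i ∈ Q <;> by_cases hj : j ∈ Q <;>
    simp [hi, hj, hij, Finset.insert_inter_of_mem, Finset.insert_inter_of_notMem,
      Finset.singleton_inter_of_mem, Finset.singleton_inter_of_notMem]
  norm_num

lemma sqCutMatrix_mulVec_pair {n : ℕ} (w : Pairs n → ℝ) {i j : Fin n} (hij : i ≠ j) :
    (sqCutMatrix n).mulVec w ⟨{i, j}, Finset.card_pair hij⟩ =
      ∑ k, pairMatrix w i k + ∑ k, pairMatrix w j k - 2 * pairMatrix w i j := by
  simp only [Matrix.mulVec, dotProduct, sqCutMatrix_apply_pair hij, sub_mul, add_mul,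
    Finset.sum_sub_distrib, Finset.sum_add_distrib, ← sum_mem_eq_sum_pairMatrix, mul_assoc,
    ite_mul, one_mul, zero_mul, ← Finset.mul_sum, pairMatrix_of_ne w hij]
  simp

/-- Row sums of a function with zero diagonal that is, off the diagonal, an affine expression in
another such function and the values at the two indices of a function of one variable. -/
lemma row_sum_of_offDiag {n : ℕ} {f g : Fin n → Fin n → ℝ} {h : Fin n → ℝ} {a c : ℝ}
    (hf : ∀ i, f i i = 0) (hg : ∀ i, g i i = 0)
    (hfg : ∀ i j, i ≠ j → f i j = a * g i j + c + (h i + h j)) (i : Fin n) :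
    ∑ j, f i j = a * ∑ j, g i j + (n - 1) * c + (n - 2) * h i + ∑ j, h j := by
  have hall : ∀ j, f i j = a * g i j + c + (h i + h j) - if i = j then c + 2 * h i else 0 := by
    intro j
    by_cases hij : i = j
    · subst hij
      simp only [hf, hg, if_true]
      ring
    · simp [hij, hfg i j hij]
  simp only [hall, Finset.sum_sub_distrib, Finset.sum_add_distrib, ← Finset.mul_sum,
    Finset.sum_const, Finset.card_univ, Fintype.card_fin, nsmul_eq_mul, Finset.sum_ite_eq,
    Finset.mem_univ, if_true]
  ring

lemma offDiag_cut_iff {n : ℕ} (hn : 5 ≤ n) {x d : Fin n → Fin n → ℝ} (hx : ∀ i, x i i = 0)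
    (hd : ∀ i, d i i = 0) :
    (∀ i j, i ≠ j → ∑ k, x i k + ∑ k, x j k - 2 * x i j = d i j) ↔
      ∀ i j, i ≠ j → x i j = -(1 / 2) * d i j
        - (∑ k, ∑ l, d k l) / 2 / (((n : ℝ) - 2) * ((n : ℝ) - 4)) +
          (∑ k, d i k + ∑ k, d j k) / (2 * ((n : ℝ) - 4)) := by
  have hn' : (5 : ℝ) ≤ n := by exact_mod_cast hn
  have h2 : (n : ℝ) - 2 ≠ 0 := by linarith
  have h4 : (n : ℝ) - 4 ≠ 0 := by linarith
  constructor
  · intro H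
    have hrow := row_sum_of_offDiag (f := d) (g := x) (h := fun i => ∑ k, x i k) (a := -2) (c := 0)
      hd hx fun i j hij => by rw [← H i j hij]; ring
    have htot : ∑ k, ∑ l, d k l = 2 * (n - 2) * ∑ k, ∑ l, x k l := by
      simp only [hrow, Finset.sum_add_distrib, ← Finset.mul_sum, Finset.sum_const,
        Finset.card_univ, Fintype.card_fin, nsmul_eq_mul]
      ring
    intro i j hij
    rw [htot, hrow i, hrow j, ← H i j hij]
    field_simp
    ring
  · intro H
    have hrow := row_sum_of_offDiag (f := x) (g := d)
      (h := fun i => (∑ k, d i k) / (2 * ((n : ℝ) - 4))) (a := -(1 / 2))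
      (c := -((∑ k, ∑ l, d k l) / 2 / (((n : ℝ) - 2) * ((n : ℝ) - 4))))
      hx hd fun i j hij => by rw [H i j hij]; ring
    intro i j hij
    rw [hrow i, hrow j, H i j hij, ← Finset.sum_div]
    field_simp
    ring

/-- For `n ≥ 5` and a metric `d` on `V_n` (regarded as a vector in
`ℝ^{C(n,2)}`), a vector `w` solves `S_sq·w = d` iff its coordinates are
`w_{ij} = −(1/2)·d(i,j) − Tr(d)/((n−2)(n−4)) + (s_i+s_j)/(2(n−4))`; in particular
this is the unique solution of the system. -/
theorem sqCutMatrix_solution_formula (n : ℕ) (hn : 5 ≤ n)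
    (d : Fin n → Fin n → ℝ) (hd : IsMetric d) (w : Pairs n → ℝ) :
    (sqCutMatrix n).mulVec w = (fun P => pairEval d P.1) ↔
      ∀ (i j : Fin n) (hij : i ≠ j),
        w ⟨{i, j}, Finset.card_pair hij⟩ =
          -(1 / 2) * d i j - traceMetric d / (((n : ℝ) - 2) * ((n : ℝ) - 4)) +
            (starTrace d i + starTrace d j) / (2 * ((n : ℝ) - 4)) := by
  obtain ⟨h0, hs, -, -⟩ := hd
  have htr : traceMetric d = (∑ k, ∑ l, d k l) / 2 := by
    rw [← two_mul_traceMetric h0 hs]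
    ring
  simp only [starTrace_eq_sum h0, htr]
  refine Iff.trans ?_ ((offDiag_cut_iff hn (pairMatrix_self w) h0).trans ?_)
  · constructor
    · intro H i j hij
      rw [← sqCutMatrix_mulVec_pair w hij, H]
      exact pairEval_pair h0 hs hij
    · intro H
      ext ⟨P, hP⟩
      obtain ⟨i, j, hij, rfl⟩ := Finset.card_eq_two.mp hP
      rw [sqCutMatrix_mulVec_pair w hij, H i j hij, pairEval_pair h0 hs hij]
  · refine forall_congr' fun i => forall_congr' fun j => forall_congr' fun hij => ?_
    rw [pairMatrix_of_ne w hij]
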